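/- For every Z ∈ Υ_reg^N (a normalised point of the hyperplane complement), the imaginary part Z_im lies in the interior T_R° of the Tits cone. -/

import Mathlib

noncomputable def coxEntry {B : Type*} (M : CoxeterMatrix B) (s t : B) : ℝ :=
  if M s t = 0 then -2 else -2 * Real.cos (Real.pi / (M s t))

noncomputable def coxForm {B : Type*} [Fintype B] (M : CoxeterMatrix B) (v w : B → ℝ) : ℝ :=
  ∑ s, ∑ t, v s * w t * coxEntry M s t

/-- The simple root `α_s` in `RΛ ≅ (B → ℝ)`. -/
noncomputable def simpleRoot {B : Type*} [DecidableEq B] (s : B) : B → ℝ := Pi.single s 1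

/-- The set of real roots: the `W`-orbit of the simple roots under the Tits representation. -/
def rootSet {B : Type*} [DecidableEq B] {W : Type*} [Group W]
    (ρ : W →* ((B → ℝ) ≃ₗ[ℝ] (B → ℝ))) : Set (B → ℝ) :=
  {v | ∃ (w : W) (s : B), v = ρ w (simpleRoot s)}

/-- The set of positive real roots. -/
def posRootSet {B : Type*} [DecidableEq B] {W : Type*} [Group W]
    (ρ : W →* ((B → ℝ) ≃ₗ[ℝ] (B → ℝ))) : Set (B → ℝ) :=
  {v ∈ rootSet ρ | ∀ i, 0 ≤ v i}

/-- The set `K = {v ∈ ℝ_{≥0}Λ : B(v, α_s) ≤ 0 for all s}`. -/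
noncomputable def coneK {B : Type*} [Fintype B] [DecidableEq B] (M : CoxeterMatrix B) :
    Set (B → ℝ) :=
  {v | (∀ i, 0 ≤ v i) ∧ ∀ s, coxForm M v (simpleRoot s) ≤ 0}

/-- The closed imaginary cone `I = closure (W · K)`. -/
noncomputable def imagCone {B : Type*} [Fintype B] [DecidableEq B] (M : CoxeterMatrix B)
    {W : Type*} [Group W] (ρ : W →* ((B → ℝ) ≃ₗ[ℝ] (B → ℝ))) : Set (B → ℝ) :=
  closure {v | ∃ (w : W), ∃ k ∈ coneK M, v = ρ w k}


/-- The pairing between the dual space `(RΛ)*` (in coordinates: `z : B → ℝ`, with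
`z i = Z(α_i)`) and `RΛ`. -/
def evalR {B : Type*} [Fintype B] (z : B → ℝ) (v : B → ℝ) : ℝ := ∑ i, v i * z i

/-- The Tits cone `T = W · C̄` in the dual space, written in coordinates. -/
def titsConeCoord {B : Type*} [Fintype B] [DecidableEq B] {W : Type*} [Group W]
    (ρ : W →* ((B → ℝ) ≃ₗ[ℝ] (B → ℝ))) : Set (B → ℝ) :=
  {z | ∃ w : W, ∀ s : B, 0 ≤ evalR z (ρ w (simpleRoot s))}

/-- The pairing between the complexified dual space `(RΛ)*_ℂ = Hom_ℝ(RΛ, ℂ)` (in coordinates: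
`z : B → ℂ`, with `z i = Z(α_i)`) and `RΛ`. -/
noncomputable def evalC {B : Type*} [Fintype B] (z : B → ℂ) (v : B → ℝ) : ℂ := ∑ i, (v i : ℂ) * z i

/-- The hyperplane complement `Υ_reg`: the complement in `(RΛ)*_ℂ` of the hyperplanes `H_v`
for nonzero `v` in the closed imaginary cone and the hyperplanes `H_α` for positive real
roots `α`. -/
noncomputable def upsReg {B : Type*} [Fintype B] [DecidableEq B] (M : CoxeterMatrix B)
    {W : Type*} [Group W] (ρ : W →* ((B → ℝ) ≃ₗ[ℝ] (B → ℝ))) : Set (B → ℂ) :=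
  {z | (∀ v ∈ imagCone M ρ, v ≠ 0 → evalC z v ≠ 0) ∧ ∀ α ∈ posRootSet ρ, evalC z α ≠ 0}

/-- The argument `φ^I(Z)` of the middle ray of the proper closed convex cone `Z(I) ⊆ ℂ`
(for `Z ∈ Υ` with `I ≠ {0}`): the average of the extremal arguments of `Z(I \ {0})`. -/
noncomputable def phiI {B : Type*} [Fintype B] [DecidableEq B] (M : CoxeterMatrix B)
    {W : Type*} [Group W] (ρ : W →* ((B → ℝ) ≃ₗ[ℝ] (B → ℝ))) (z : B → ℂ) : ℝ :=
  (sSup (Complex.arg '' ((fun v => evalC z v) '' (imagCone M ρ \ {0}))) +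
    sInf (Complex.arg '' ((fun v => evalC z v) '' (imagCone M ρ \ {0})))) / 2

open Classical in
/-- The normalised hyperplane complement `Υ_reg^N = {Z ∈ Υ_reg : φ^I(Z) = π/2}`; by
convention `Υ_reg^N := Υ_reg` when `I = {0}`. -/
noncomputable def upsRegN {B : Type*} [Fintype B] [DecidableEq B] (M : CoxeterMatrix B)
    {W : Type*} [Group W] (ρ : W →* ((B → ℝ) ≃ₗ[ℝ] (B → ℝ))) : Set (B → ℂ) :=
  if imagCone M ρ = {0} then upsReg M ρ
  else {z ∈ upsReg M ρ | phiI M ρ z = Real.pi / 2}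

/-- The contragredient action of `w ∈ W` on the complexified dual space, in coordinates:
`(w · Z)(v) = Z(ρ(w⁻¹) v)`. -/
noncomputable def wact {B : Type*} [Fintype B] [DecidableEq B]
    {W : Type*} [Group W] (ρ : W →* ((B → ℝ) ≃ₗ[ℝ] (B → ℝ))) (w : W) (z : B → ℂ) :
    B → ℂ :=
  fun i => evalC z (ρ w⁻¹ (simpleRoot i))

section Aux

set_option linter.unusedSectionVars false

variable {B : Type*} [Fintype B] [DecidableEq B] (M : CoxeterMatrix B)

/-- The Coxeter form as a bilinear map. -/
noncomputable def cB : (B → ℝ) →ₗ[ℝ] (B → ℝ) →ₗ[ℝ] ℝ :=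
  LinearMap.mk₂ ℝ (coxForm M)
    (by intro a b c; simp [coxForm, add_mul, Finset.sum_add_distrib])
    (by intro r a b; simp [coxForm, Finset.mul_sum, mul_assoc])
    (by intro a b c; simp [coxForm, add_mul, mul_add, Finset.sum_add_distrib])
    (by intro r a b
        simp only [coxForm, Finset.mul_sum, Pi.smul_apply, smul_eq_mul]
        refine Finset.sum_congr rfl fun i _ => Finset.sum_congr rfl fun j _ => ?_
        ring)

lemma coxForm_eq (v w : B → ℝ) : coxForm M v w = cB M v w := rfl

lemma coxEntry_symm (s t : B) : coxEntry M s t = coxEntry M t s := by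
  simp [coxEntry, M.symmetric s t]

lemma coxEntry_self (s : B) : coxEntry M s s = 2 := by
  simp [coxEntry]

lemma coxEntry_le_two (s t : B) : coxEntry M s t ≤ 2 := by
  unfold coxEntry
  split_ifs
  · norm_num
  · linarith [Real.neg_one_le_cos (Real.pi / (M s t))]

lemma two_le_M {s t : B} (h : s ≠ t) (h0 : M s t ≠ 0) : 2 ≤ M s t := by
  have := M.off_diagonal s t h
  omega

lemma coxEntry_nonpos {s t : B} (h : s ≠ t) : coxEntry M s t ≤ 0 := by
  unfold coxEntry
  split_ifs with h0
  · norm_num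
  · have h2 : (2 : ℝ) ≤ M s t := by exact_mod_cast two_le_M M h h0
    have : 0 ≤ Real.cos (Real.pi / (M s t)) := by
      apply Real.cos_nonneg_of_mem_Icc
      constructor
      · have : 0 ≤ Real.pi / (M s t) := by positivity
        linarith [Real.pi_pos]
      · exact div_le_div_of_nonneg_left Real.pi_pos.le (by norm_num) h2
    linarith

lemma cB_single_left (s : B) (v : B → ℝ) :
    cB M (simpleRoot s) v = ∑ t, v t * coxEntry M s t := by
  rw [← coxForm_eq]
  unfold coxForm simpleRoot
  rw [Finset.sum_eq_single s]
  · simp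
  · intro b _ hb; simp [hb]
  · simp

lemma cB_symm (v w : B → ℝ) : cB M v w = cB M w v := by
  rw [← coxForm_eq, ← coxForm_eq]
  unfold coxForm
  rw [Finset.sum_comm]
  refine Finset.sum_congr rfl fun i _ => Finset.sum_congr rfl fun j _ => ?_
  rw [coxEntry_symm]; ring

lemma cB_single_single (s t : B) : cB M (simpleRoot s) (simpleRoot t) = coxEntry M s t := by
  rw [cB_single_left]
  simp [simpleRoot, Pi.single_apply]

lemma cB_eq_sum (v w : B → ℝ) : cB M v w = ∑ s, v s * cB M (simpleRoot s) w := by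
  simp only [cB_single_left]
  rw [← coxForm_eq]
  unfold coxForm
  refine Finset.sum_congr rfl fun i _ => ?_
  rw [Finset.mul_sum]
  refine Finset.sum_congr rfl fun j _ => ?_
  ring

/-- coefficient sequence for dihedral roots. -/
noncomputable def sig (m : ℕ) (k : ℕ) : ℝ :=
  if m = 0 then k else Real.sin (k * (Real.pi / m)) / Real.sin (Real.pi / m)

lemma sig_nonneg (m k : ℕ) (h : m = 0 ∨ k ≤ m) : 0 ≤ sig m k := by
  unfold sig
  split_ifs with h0
  · positivity
  · have hk : k ≤ m := by tauto
    have hm : (0:ℝ) < m := by exact_mod_cast Nat.pos_of_ne_zero h0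
    have hm1 : (1:ℝ) ≤ m := by exact_mod_cast Nat.pos_of_ne_zero h0
    have hk' : (k:ℝ) ≤ m := by exact_mod_cast hk
    apply div_nonneg
    · apply Real.sin_nonneg_of_nonneg_of_le_pi
      · positivity
      · calc (k:ℝ) * (Real.pi / m) ≤ m * (Real.pi / m) := by gcongr
          _ = Real.pi := by field_simp
    · apply Real.sin_nonneg_of_nonneg_of_le_pi
      · positivity
      · exact div_le_self Real.pi_pos.le hm1

lemma sig_zero (m : ℕ) : sig m 0 = 0 := by simp [sig]

lemma sig_one {s t : B} (h : s ≠ t) : sig (M s t) 1 = 1 := by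
  unfold sig
  split_ifs with h0
  · simp
  · have h2 : (2 : ℝ) ≤ M s t := by exact_mod_cast two_le_M M h h0
    have : 0 < Real.sin (Real.pi / M s t) := by
      apply Real.sin_pos_of_pos_of_lt_pi
      · have := Real.pi_pos; positivity
      · exact div_lt_self Real.pi_pos (by linarith)
    simp [this.ne']

lemma sig_rec {s t : B} (k : ℕ) :
    sig (M s t) (k + 2) = - coxEntry M s t * sig (M s t) (k + 1) - sig (M s t) k := by
  unfold sig coxEntry
  split_ifs with h0
  · push_cast; ring
  · set x := Real.pi / (M s t : ℝ)
    have e1 : ((k + 2 : ℕ) : ℝ) * x = (k + 1 : ℕ) * x + x := by push_cast; ring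
    have e2 : ((k : ℕ) : ℝ) * x = (k + 1 : ℕ) * x - x := by push_cast; ring
    rw [e1, e2, Real.sin_add, Real.sin_sub]
    ring

variable {W : Type*} [Group W] (cs : CoxeterSystem M W)
    (ρ : W →* ((B → ℝ) ≃ₗ[ℝ] (B → ℝ)))
    (hρ : ∀ (s : B) (v : B → ℝ),
      ρ (cs.simple s) v = v - coxForm M (simpleRoot s) v • simpleRoot s)

include hρ

lemma rho_simple (s : B) (v : B → ℝ) :
    ρ (cs.simple s) v = v - cB M (simpleRoot s) v • simpleRoot s := hρ s v

lemma rho_simple_self (s : B) : ρ (cs.simple s) (simpleRoot s) = - simpleRoot s := by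
  rw [rho_simple M cs ρ hρ, cB_single_single, coxEntry_self]
  module

lemma rho_mul_simple (w : W) (s : B) (v : B → ℝ) :
    ρ (w * cs.simple s) v = ρ w v - cB M (simpleRoot s) v • ρ w (simpleRoot s) := by
  rw [map_mul, LinearEquiv.mul_apply, rho_simple M cs ρ hρ, map_sub, map_smul]

lemma cB_inv (w : W) (u v : B → ℝ) : cB M (ρ w u) (ρ w v) = cB M u v := by
  induction w using cs.simple_induction_left with
  | one => simp
  | mul_simple_left w s ih =>
    rw [map_mul, LinearEquiv.mul_apply, LinearEquiv.mul_apply, rho_simple M cs ρ hρ,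
      rho_simple M cs ρ hρ, ← ih]
    simp only [map_sub, map_smul, LinearMap.sub_apply, LinearMap.smul_apply, smul_eq_mul,
      cB_single_single, coxEntry_self]
    rw [cB_symm M (ρ w u) (simpleRoot s)]
    ring

open CoxeterSystem in
lemma rho_alt {s t : B} (h : s ≠ t) (k : ℕ) :
    ρ (cs.wordProd (alternatingWord s t k)) (simpleRoot s) =
      (if Even k then sig (M s t) (k + 1) else sig (M s t) k) • simpleRoot s +
      (if Even k then sig (M s t) k else sig (M s t) (k + 1)) • simpleRoot t := by
  induction k using Nat.strong_induction_on generalizing s t with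
  | _ k ih =>
    match k with
    | 0 => simp [alternatingWord, sig_zero, sig_one M h]
    | 1 =>
      have := sig_rec M (s := s) (t := t) 0
      simp only [zero_add, sig_one M h, sig_zero] at this
      simp [alternatingWord, sig_one M h, rho_simple M cs ρ hρ, cB_single_single, this,
        coxEntry_symm M t s, sub_eq_add_neg]
    | k + 2 =>
      have h1 := ih (k + 1) (by omega) h.symm
      have h0 := ih k (by omega) h
      rw [alternatingWord_succ, wordProd_concat, rho_mul_simple M cs ρ hρ, h1,
        alternatingWord_succ, wordProd_concat, rho_mul_simple M cs ρ hρ, h0, cB_single_single,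
        cB_single_single, coxEntry_self, M.symmetric t s, sig_rec M (k + 1), sig_rec M k,
        coxEntry_symm M t s]
      by_cases hk : Even k
      · simp only [Nat.even_add_one, hk]
        simp only [not_true_eq_false, not_false_eq_true, if_true, if_false]
        module
      · simp only [Nat.even_add_one, hk]
        simp only [not_true_eq_false, not_false_eq_true, if_true, if_false]
        module

open CoxeterSystem in
lemma root_pos (w : W) (s : B) (hw : cs.length w < cs.length (w * cs.simple s)) :
    0 ≤ ρ w (simpleRoot s) := by
  induction hn : cs.length w using Nat.strong_induction_on generalizing w s with
  | _ n ih =>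
    by_cases hw1 : w = 1
    · subst hw1
      intro i
      simp only [map_one, simpleRoot, Pi.zero_apply, LinearEquiv.coe_one, id_eq]
      rw [Pi.single_apply]; split_ifs <;> norm_num
    obtain ⟨t, ht⟩ := cs.exists_rightDescent_of_ne_one hw1
    have hst : s ≠ t := by
      rintro rfl
      unfold IsRightDescent at ht
      omega
    let P : ℕ → Prop := fun k => ∃ v, w = v * cs.wordProd (alternatingWord s t k) ∧
      cs.length w = cs.length v + k
    have hP1 : P 1 := by
      refine ⟨w * cs.simple t, by simp [alternatingWord], ?_⟩
      exact ((cs.isRightDescent_iff).1 ht).symm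
    have hPb : ∀ k, P k → k ≤ n := by
      rintro k ⟨v, -, hv⟩; omega
    have hn1 : 1 ≤ n := hPb 1 hP1
    classical
    set k := Nat.findGreatest P n with hk
    have hPk : P k := Nat.findGreatest_spec hn1 hP1
    have hk1 : 1 ≤ k := Nat.le_findGreatest hn1 hP1
    have hPk' : ¬ P (k + 1) := by
      intro h
      have := Nat.le_findGreatest (hPb _ h) h
      omega
    obtain ⟨v, hv, hl⟩ := hPk
    have hr : ∀ r, (r = s ∨ r = t) → cs.length v < cs.length (v * cs.simple r) := by
      -- first letters
      have hA : cs.length v < cs.length (v * cs.simple (if Even k then t else s)) := by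
        by_contra hcon
        rcases cs.length_mul_simple v (if Even k then t else s) with h | h
        · omega
        apply hPk'
        refine ⟨v * cs.simple (if Even k then t else s), ?_, by omega⟩
        rw [alternatingWord_succ', wordProd_cons]
        simpa [mul_assoc] using hv
      have hB : cs.length v < cs.length (v * cs.simple (if Even k then s else t)) := by
        by_contra hcon
        rcases cs.length_mul_simple v (if Even k then s else t) with h | h
        · omega
        obtain ⟨j, hj⟩ : ∃ j, k = j + 1 := ⟨k - 1, by omega⟩
        rw [hj, alternatingWord_succ', wordProd_cons] at hv
        have he : (if Even k then s else t) = (if Even j then t else s) := by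
          rw [hj]
          by_cases hje : Even j
          · rw [if_pos hje, if_neg (by simpa [Nat.even_add_one] using hje)]
          · rw [if_neg hje, if_pos (by simpa [Nat.even_add_one] using hje)]
        rw [he] at h
        rw [← mul_assoc] at hv
        have h3 := cs.length_mul_le (v * cs.simple (if Even j then t else s))
          (cs.wordProd (alternatingWord s t j))
        have h4 := cs.length_wordProd_le (alternatingWord s t j)
        rw [← hv] at h3
        simp only [length_alternatingWord] at h4
        omega
      rintro r (rfl | rfl)
      · split_ifs at hA hB <;> assumption
      · split_ifs at hA hB <;> assumption
    have hvs := ih (cs.length v) (by omega) v s (hr s (Or.inl rfl)) rfl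
    have hvt := ih (cs.length v) (by omega) v t (hr t (Or.inr rfl)) rfl
    have hkm : M s t = 0 ∨ k + 1 ≤ M s t := by
      by_contra hcon
      push Not at hcon
      have hnr := cs.not_isReduced_alternatingWord t s (m := k + 1)
        (by rw [M.symmetric]; exact hcon.1) (by rw [M.symmetric]; omega)
      apply hnr
      unfold CoxeterSystem.IsReduced
      rw [length_alternatingWord]
      apply le_antisymm
      · have := cs.length_wordProd_le (alternatingWord t s (k + 1))
        simpa using this
      · rw [alternatingWord_succ, wordProd_concat]
        have h3 := cs.length_mul_le v (cs.wordProd (alternatingWord s t k) * cs.simple s)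
        rw [← mul_assoc, ← hv] at h3
        omega
    rw [hv, map_mul, LinearEquiv.mul_apply, rho_alt M cs ρ hρ hst, map_add, map_smul, map_smul]
    have n1 : 0 ≤ sig (M s t) (k + 1) := sig_nonneg _ _ hkm
    have n2 : 0 ≤ sig (M s t) k := sig_nonneg _ _ (by omega)
    apply add_nonneg <;> apply smul_nonneg <;> first | assumption | (split_ifs <;> assumption)

lemma root_dich (β : B → ℝ) (h : β ∈ rootSet ρ) : 0 ≤ β ∨ β ≤ 0 := by
  obtain ⟨w, s, rfl⟩ := h
  rcases cs.length_mul_simple w s with h | h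
  · left
    exact root_pos M cs ρ hρ w s (by omega)
  · right
    have := root_pos M cs ρ hρ (w * cs.simple s) s (by simp; omega)
    rw [rho_mul_simple M cs ρ hρ, cB_single_single, coxEntry_self] at this
    intro i
    have := this i
    simp at this
    simp
    linarith

lemma root_norm (β : B → ℝ) (h : β ∈ rootSet ρ) : cB M β β = 2 := by
  obtain ⟨w, s, rfl⟩ := h
  rw [cB_inv M cs ρ hρ, cB_single_single, coxEntry_self]

lemma root_ne_zero (β : B → ℝ) (h : β ∈ rootSet ρ) : β ≠ 0 := by
  rintro rfl
  have := root_norm M cs ρ hρ 0 h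
  simp at this

lemma root_not_both (β : B → ℝ) (h : β ∈ rootSet ρ) (h1 : 0 ≤ β) (h2 : β ≤ 0) : False :=
  root_ne_zero M cs ρ hρ β h (le_antisymm h2 h1)

omit hρ in
lemma root_act (w : W) (β : B → ℝ) (h : β ∈ rootSet ρ) : ρ w β ∈ rootSet ρ := by
  obtain ⟨u, s, rfl⟩ := h
  exact ⟨w * u, s, by simp⟩

omit hρ in
lemma simple_mem (s : B) : simpleRoot s ∈ rootSet ρ := ⟨1, s, by simp⟩

lemma root_neg (β : B → ℝ) (h : β ∈ rootSet ρ) : -β ∈ rootSet ρ := by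
  obtain ⟨u, s, rfl⟩ := h
  refine ⟨u * cs.simple s, s, ?_⟩
  rw [map_mul, LinearEquiv.mul_apply, rho_simple_self M cs ρ hρ, map_neg]

omit hρ in
lemma simpleRoot_nonneg (s : B) : 0 ≤ (simpleRoot s : B → ℝ) := by
  intro i
  simp only [simpleRoot, Pi.single_apply, Pi.zero_apply]
  split_ifs <;> norm_num

/-- Sum of coordinates. -/
def sm (v : B → ℝ) : ℝ := ∑ i, v i

omit hρ in
lemma sm_add (v w : B → ℝ) : sm (v + w) = sm v + sm w := by
  simp [sm, Finset.sum_add_distrib]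

omit hρ in
lemma sm_sub (v w : B → ℝ) : sm (v - w) = sm v - sm w := by
  simp [sm, Finset.sum_sub_distrib]

omit hρ in
lemma sm_smul (r : ℝ) (w : B → ℝ) : sm (r • w) = r * sm w := by
  simp [sm, Finset.mul_sum]

omit hρ in
lemma sm_mono {v w : B → ℝ} (h : v ≤ w) : sm v ≤ sm w :=
  Finset.sum_le_sum fun i _ => h i

omit hρ in
lemma sm_nonneg {v : B → ℝ} (h : 0 ≤ v) : 0 ≤ sm v :=
  Finset.sum_nonneg fun i _ => h i

omit hρ in
lemma sm_simple (s : B) : sm (simpleRoot s : B → ℝ) = 1 := by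
  simp [sm, simpleRoot]

lemma root_sm (β : B → ℝ) (h : β ∈ rootSet ρ) (h0 : 0 ≤ β) : 1 ≤ sm β := by
  have h1 := root_norm M cs ρ hρ β h
  have h2 : cB M β β ≤ 2 * (sm β * sm β) := by
    rw [← coxForm_eq]
    unfold coxForm sm
    rw [Finset.sum_mul_sum, Finset.mul_sum]
    refine Finset.sum_le_sum fun i _ => ?_
    rw [Finset.mul_sum]
    refine Finset.sum_le_sum fun j _ => ?_
    have a := mul_nonneg (h0 i) (h0 j)
    have b := coxEntry_le_two M i j
    nlinarith
  have h3 := sm_nonneg h0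
  nlinarith

lemma simple_perm (s : B) (β : B → ℝ) (h : β ∈ rootSet ρ) (h0 : 0 ≤ β) (hs : β ≠ simpleRoot s) :
    0 ≤ ρ (cs.simple s) β := by
  rcases root_dich M cs ρ hρ _ (root_act ρ (cs.simple s) β h) with h1 | h1
  · exact h1
  exfalso
  have hz : ∀ i, i ≠ s → β i = 0 := by
    intro i hi
    have := h1 i
    rw [rho_simple M cs ρ hρ] at this
    simp [simpleRoot, hi] at this
    exact le_antisymm this (h0 i)
  have hb : β = β s • simpleRoot s := by
    ext i
    by_cases hi : i = s
    · subst hi; simp [simpleRoot]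
    · simp [simpleRoot, hi, hz i hi]
  have hn := root_norm M cs ρ hρ β h
  rw [hb] at hn
  simp only [map_smul, LinearMap.smul_apply, cB_single_single, coxEntry_self, smul_eq_mul] at hn
  have h00 := h0 s
  simp only [Pi.zero_apply] at h00
  have : β s = 1 := by nlinarith
  rw [this, one_smul] at hb
  exact hs hb

/-- The inversion set. -/
def Ninv (w : W) : Set (B → ℝ) := {β | β ∈ rootSet ρ ∧ 0 ≤ β ∧ ρ w β ≤ 0}

lemma Ninv_insert (w : W) (s : B) (h : 0 ≤ ρ w⁻¹ (simpleRoot s)) :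
    Ninv ρ (cs.simple s * w) = insert (ρ w⁻¹ (simpleRoot s)) (Ninv ρ w) ∧
    ρ w⁻¹ (simpleRoot s) ∉ Ninv ρ w := by
  have hww : ∀ v, ρ w (ρ w⁻¹ v) = v := by
    intro v; rw [← LinearEquiv.mul_apply, ← map_mul]; simp
  have hww' : ∀ v, ρ w⁻¹ (ρ w v) = v := by
    intro v; rw [← LinearEquiv.mul_apply, ← map_mul]; simp
  constructor
  · ext β
    simp only [Ninv, Set.mem_ofPred_eq, Set.mem_insert_iff]
    constructor
    · rintro ⟨h1, h2, h3⟩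
      rw [map_mul, LinearEquiv.mul_apply] at h3
      by_cases hb : ρ w β = simpleRoot s
      · left; rw [← hb, hww']
      · right
        refine ⟨h1, h2, ?_⟩
        rcases root_dich M cs ρ hρ _ (root_act ρ w β h1) with h4 | h4
        · exfalso
          exact root_not_both M cs ρ hρ _ (root_act ρ (cs.simple s) _ (root_act ρ w β h1))
            (simple_perm M cs ρ hρ s _ (root_act ρ w β h1) h4 hb) h3
        · exact h4
    · rintro (rfl | ⟨h1, h2, h3⟩)
      · refine ⟨root_act ρ _ _ (simple_mem ρ s), h, ?_⟩
        rw [map_mul, LinearEquiv.mul_apply, hww, rho_simple_self M cs ρ hρ]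
        simpa using simpleRoot_nonneg s
      · refine ⟨h1, h2, ?_⟩
        rw [map_mul, LinearEquiv.mul_apply]
        have hb : -(ρ w β) ≠ simpleRoot s := by
          intro hb
          have : ρ w⁻¹ (simpleRoot s) = -β := by rw [← hb, map_neg, hww']
          rw [this] at h
          exact root_not_both M cs ρ hρ β h1 h2 (by simpa using h)
        have := simple_perm M cs ρ hρ s _ (root_neg M cs ρ hρ _ (root_act ρ w β h1))
          (by simpa using h3) hb
        rw [map_neg] at this
        simpa using this
  · rintro ⟨h1, h2, h3⟩
    rw [hww] at h3
    exact root_not_both M cs ρ hρ _ (simple_mem ρ s) (simpleRoot_nonneg s) h3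

lemma Ninv_one : Ninv ρ (1 : W) = ∅ := by
  ext β
  simp only [Ninv, Set.mem_ofPred_eq, Set.mem_empty_iff_false, iff_false]
  rintro ⟨h1, h2, h3⟩
  exact root_not_both M cs ρ hρ β h1 h2 (by simpa using h3)

lemma neg_case (w : W) (s : B) :
    ρ (cs.simple s * w)⁻¹ (simpleRoot s) = - ρ w⁻¹ (simpleRoot s) := by
  rw [mul_inv_rev, cs.inv_simple, map_mul, LinearEquiv.mul_apply, rho_simple_self M cs ρ hρ,
    map_neg]

lemma Ninv_finite (w : W) : (Ninv ρ w).Finite := by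
  induction w using cs.simple_induction_left with
  | one => rw [Ninv_one M cs ρ hρ]; exact Set.finite_empty
  | mul_simple_left w s ih =>
    rcases root_dich M cs ρ hρ _ (root_act ρ w⁻¹ _ (simple_mem ρ s)) with h | h
    · rw [(Ninv_insert M cs ρ hρ w s h).1]
      exact ih.insert _
    · have h' : 0 ≤ ρ (cs.simple s * w)⁻¹ (simpleRoot s) := by
        rw [neg_case M cs ρ hρ]; simpa using h
      have := (Ninv_insert M cs ρ hρ _ s h').1
      rw [cs.simple_mul_simple_cancel_left] at this
      rw [this] at ih
      exact ih.subset (Set.subset_insert _ _)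

/-- The sum of the inversions. -/
noncomputable def xw (w : W) : B → ℝ := ∑ᶠ β ∈ Ninv ρ w, β

lemma xw_one : xw ρ (1 : W) = 0 := by
  simp [xw, Ninv_one M cs ρ hρ]

lemma xw_simple_mul_pos (w : W) (s : B) (h : 0 ≤ ρ w⁻¹ (simpleRoot s)) :
    xw ρ (cs.simple s * w) = xw ρ w + ρ w⁻¹ (simpleRoot s) := by
  obtain ⟨h1, h2⟩ := Ninv_insert M cs ρ hρ w s h
  rw [xw, h1, finsum_mem_insert _ h2 (Ninv_finite M cs ρ hρ w), add_comm]
  rfl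

lemma xw_simple_mul (w : W) (s : B) :
    xw ρ (cs.simple s * w) = xw ρ w + ρ w⁻¹ (simpleRoot s) := by
  rcases root_dich M cs ρ hρ _ (root_act ρ w⁻¹ _ (simple_mem ρ s)) with h | h
  · exact xw_simple_mul_pos M cs ρ hρ w s h
  · have h' : 0 ≤ ρ (cs.simple s * w)⁻¹ (simpleRoot s) := by
      rw [neg_case M cs ρ hρ]; simpa using h
    have := xw_simple_mul_pos M cs ρ hρ _ s h'
    rw [cs.simple_mul_simple_cancel_left, neg_case M cs ρ hρ] at this
    rw [this]; simp

omit hρ in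
lemma xw_nonneg (w : W) : 0 ≤ xw ρ w := by
  unfold xw
  exact finsum_mem_induction (p := fun v => 0 ≤ v) le_rfl (fun _ _ h1 h2 => add_nonneg h1 h2)
    (fun β h => h.2.1)

lemma root_pos_left (w : W) (s : B) (h : cs.length w < cs.length (cs.simple s * w)) :
    0 ≤ ρ w⁻¹ (simpleRoot s) := by
  apply root_pos M cs ρ hρ
  rw [cs.length_inv, ← cs.length_inv (w⁻¹ * cs.simple s)]
  simpa using h

lemma xw_length (w : W) : (cs.length w : ℝ) ≤ sm (xw ρ w) := by
  induction hn : cs.length w generalizing w with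
  | zero => simpa using sm_nonneg (xw_nonneg ρ w)
  | succ n ih =>
    have hw1 : w ≠ 1 := by rintro rfl; simp at hn
    obtain ⟨s, hs⟩ := cs.exists_leftDescent_of_ne_one hw1
    have hs' := cs.isLeftDescent_iff.1 hs
    have h1 := ih (cs.simple s * w) (by omega)
    have h2 := root_pos_left M cs ρ hρ (cs.simple s * w) s (by simp; omega)
    have h3 := xw_simple_mul M cs ρ hρ (cs.simple s * w) s
    rw [cs.simple_mul_simple_cancel_left] at h3
    rw [h3, sm_add]
    have h4 := root_sm M cs ρ hρ _ (root_act ρ _ _ (simple_mem ρ s)) h2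
    push_cast
    linarith

lemma xw_cocycle (u w : W) : ρ u (xw ρ w) = xw ρ (w * u⁻¹) - xw ρ u⁻¹ := by
  induction w using cs.simple_induction_left with
  | one => simp [xw_one M cs ρ hρ]
  | mul_simple_left w s ih =>
    rw [mul_assoc, xw_simple_mul M cs ρ hρ, xw_simple_mul M cs ρ hρ, map_add, ih,
      mul_inv_rev, inv_inv, map_mul, LinearEquiv.mul_apply]
    abel

lemma cone_grow (x : B → ℝ) (hx : x ∈ coneK M) (J : B → Prop) [DecidablePred J] (c : ℝ)
    (hc : ∀ s, J s → c ≤ - cB M (simpleRoot s) x) (ω : List B) (hω : cs.IsReduced ω) :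
    x ≤ ρ (cs.wordProd ω)⁻¹ x ∧
      sm x + c * (ω.countP (fun s => decide (J s))) ≤ sm (ρ (cs.wordProd ω)⁻¹ x) := by
  induction ω with
  | nil => simp
  | cons s ω ih =>
    have hω' : cs.IsReduced ω := by simpa using hω.drop 1
    obtain ⟨h1, h2⟩ := ih hω'
    have hlen : cs.length (cs.wordProd ω) < cs.length (cs.simple s * cs.wordProd ω) := by
      have := hω.eq
      rw [cs.wordProd_cons] at this
      rw [this, hω'.eq]; simp
    have hp := root_pos_left M cs ρ hρ _ s hlen
    have hs := root_sm M cs ρ hρ _ (root_act ρ _ _ (simple_mem ρ s)) hp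
    have hk : cB M (simpleRoot s) x ≤ 0 := by
      have := hx.2 s
      rwa [coxForm_eq, cB_symm] at this
    rw [cs.wordProd_cons, mul_inv_rev, cs.inv_simple, rho_mul_simple M cs ρ hρ]
    constructor
    · refine h1.trans ?_
      intro i
      have := hp i
      simp only [Pi.zero_apply] at this
      simp only [Pi.sub_apply, Pi.smul_apply, smul_eq_mul]
      nlinarith
    · rw [sm_sub, sm_smul, List.countP_cons]
      by_cases hJ : J s
      · have := hc s hJ
        simp only [hJ, decide_true, if_true]
        push_cast
        nlinarith
      · simp only [hJ, decide_false]
        simp only [Bool.false_eq_true, if_false, add_zero]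
        nlinarith

lemma cone_le (x : B → ℝ) (hx : x ∈ coneK M) (w : W) : x ≤ ρ w x := by
  obtain ⟨ω, h1, h2⟩ := cs.exists_isReduced w⁻¹
  have := (cone_grow M cs ρ hρ x hx (fun _ => False) 0 (by simp) ω h1).1
  rwa [← h2, inv_inv] at this

omit hρ in
lemma mem_K (v : B → ℝ) : v ∈ coneK M ↔ 0 ≤ v ∧ ∀ s, cB M (simpleRoot s) v ≤ 0 := by
  constructor
  · rintro ⟨h1, h2⟩
    refine ⟨h1, fun s => ?_⟩
    rw [cB_symm]; exact h2 s
  · rintro ⟨h1, h2⟩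
    refine ⟨h1, fun s => ?_⟩
    rw [coxForm_eq, cB_symm]; exact h2 s

omit hρ in
lemma exists_max : ∃ x ∈ coneK M, ∀ y ∈ coneK M, ∀ s, cB M (simpleRoot s) y < 0 →
    cB M (simpleRoot s) x < 0 := by
  have h : ∀ s : B, ∃ y ∈ coneK M, ∀ y' ∈ coneK M, cB M (simpleRoot s) y' < 0 →
      cB M (simpleRoot s) y < 0 := by
    intro s
    by_cases hs : ∃ y ∈ coneK M, cB M (simpleRoot s) y < 0
    · obtain ⟨y, h1, h2⟩ := hs
      exact ⟨y, h1, fun _ _ _ => h2⟩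
    · refine ⟨0, by rw [mem_K]; simp, fun y' h1 h2 => absurd ⟨y', h1, h2⟩ hs⟩
  choose y hy1 hy2 using h
  simp only [mem_K] at hy1
  refine ⟨∑ s, y s, ?_, ?_⟩
  · rw [mem_K]
    refine ⟨Finset.sum_nonneg fun s _ => (hy1 s).1, fun s => ?_⟩
    rw [map_sum]
    exact Finset.sum_nonpos fun r _ => (hy1 r).2 s
  · intro z hz s hs
    rw [map_sum]
    exact Finset.sum_neg' (fun r _ => (hy1 r).2 s) ⟨s, Finset.mem_univ _, hy2 s z hz hs⟩

omit hρ in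
lemma max_orth (x : B → ℝ) (hx : x ∈ coneK M)
    (hmax : ∀ y ∈ coneK M, ∀ s, cB M (simpleRoot s) y < 0 → cB M (simpleRoot s) x < 0)
    (s t : B) (hs : ¬ cB M (simpleRoot s) x < 0) (ht : cB M (simpleRoot t) x < 0) :
    coxEntry M s t = 0 := by
  have hst : s ≠ t := by rintro rfl; exact hs ht
  by_contra hne
  have hneg := lt_of_le_of_ne (coxEntry_nonpos M hst) hne
  rw [mem_K] at hx
  set e := - cB M (simpleRoot t) x / 4 with he
  have he0 : 0 < e := by rw [he]; linarith
  apply hs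
  apply hmax (x + e • simpleRoot t)
  · rw [mem_K]
    refine ⟨add_nonneg hx.1 (smul_nonneg he0.le (simpleRoot_nonneg t)), fun r => ?_⟩
    rw [map_add, map_smul, cB_single_single, smul_eq_mul]
    by_cases hr : r = t
    · subst hr; rw [coxEntry_self]; linarith
    · have := coxEntry_nonpos M hr
      have := hx.2 r
      nlinarith
  · rw [map_add, map_smul, cB_single_single, smul_eq_mul]
    have := hx.2 s
    nlinarith

omit hρ in
lemma cB_cont (s : B → ℝ) : Continuous (fun y => cB M s y) :=
  LinearMap.continuous_of_finiteDimensional _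

omit hρ in
lemma q_cont : Continuous (fun y => cB M y y) := by
  have : (fun y => cB M y y) = fun y : B → ℝ => ∑ s, ∑ t, y s * y t * coxEntry M s t := rfl
  rw [this]
  fun_prop

omit hρ in
lemma sm_cont : Continuous (fun y : B → ℝ => sm y) := by
  unfold sm; fun_prop

omit hρ in
lemma le_sm {y : B → ℝ} (h : 0 ≤ y) (i : B) : y i ≤ sm y :=
  Finset.single_le_sum (f := y) (fun j _ => h j) (Finset.mem_univ i)

omit hρ in
lemma compact_slice (S : Set (B → ℝ)) (hS : IsClosed S) (h0 : ∀ y ∈ S, 0 ≤ y) (c : ℝ)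
    (hc : ∀ y ∈ S, sm y ≤ c) : IsCompact S := by
  refine (isCompact_Icc (a := (0 : B → ℝ)) (b := fun _ => c)).of_isClosed_subset hS ?_
  intro y hy
  exact ⟨h0 y hy, fun i => (le_sm (h0 y hy) i).trans (hc y hy)⟩

omit hρ in
lemma max_psd (x : B → ℝ) (hx : x ∈ coneK M)
    (hmax : ∀ y ∈ coneK M, ∀ s, cB M (simpleRoot s) y < 0 → cB M (simpleRoot s) x < 0)
    (y : B → ℝ) (hy : ∀ s, cB M (simpleRoot s) x < 0 → y s = 0) : 0 ≤ cB M y y := by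
  by_contra hneg
  push Not at hneg
  set a : B → ℝ := fun i => |y i| with ha
  have ha0 : 0 ≤ a := fun i => abs_nonneg _
  have hqa : cB M a a ≤ cB M y y := by
    rw [← coxForm_eq, ← coxForm_eq]
    unfold coxForm
    refine Finset.sum_le_sum fun i _ => Finset.sum_le_sum fun j _ => ?_
    by_cases hij : i = j
    · subst hij
      rw [ha]; simp
    · have h1 := coxEntry_nonpos M hij
      have h2 : y i * y j ≤ |y i| * |y j| := by rw [← abs_mul]; exact le_abs_self _
      rw [ha]; simp only
      nlinarith
  have hsa : 0 < sm a := by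
    rcases (sm_nonneg ha0).lt_or_eq with h | h
    · exact h
    exfalso
    have : a = 0 := by
      ext i
      exact le_antisymm (by rw [Pi.zero_apply, h]; exact le_sm ha0 i) (ha0 i)
    rw [this] at hqa
    simp at hqa
    linarith
  let S : Set (B → ℝ) := {p | 0 ≤ p ∧ (∀ s, cB M (simpleRoot s) x < 0 → p s = 0) ∧ sm p = 1}
  have hSc : IsClosed S := by
    have h1 : S = Set.Ici 0 ∩ ((⋂ s, ⋂ (_ : cB M (simpleRoot s) x < 0), {p : B → ℝ | p s = 0}) ∩
        {p | sm p = 1}) := by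
      ext p; simp [S]
    rw [h1]
    refine isClosed_Ici.inter (IsClosed.inter ?_ (isClosed_eq sm_cont continuous_const))
    exact isClosed_iInter fun s => isClosed_iInter fun _ =>
          isClosed_eq (continuous_apply s) continuous_const
  have hScomp : IsCompact S := compact_slice S hSc (fun p hp => hp.1) 1 (fun p hp => hp.2.2.le)
  have haS : (sm a)⁻¹ • a ∈ S := by
    refine ⟨smul_nonneg (by positivity) ha0, fun s hs => ?_, ?_⟩
    · simp [ha, hy s hs]
    · rw [sm_smul]; field_simp
  obtain ⟨p, hp, hpmin⟩ := hScomp.exists_isMinOn ⟨_, haS⟩ (q_cont M).continuousOn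
  have hpmin : ∀ p' ∈ S, cB M p p ≤ cB M p' p' := fun p' h => hpmin h
  set l := cB M p p with hl
  have hl0 : l < 0 := by
    have := hpmin _ haS
    simp only [map_smul, LinearMap.smul_apply, smul_eq_mul] at this
    have h2 : (sm a)⁻¹ * ((sm a)⁻¹ * cB M a a) < 0 := by
      have : 0 < (sm a)⁻¹ := by positivity
      have h3 : cB M a a < 0 := by linarith
      exact mul_neg_of_pos_of_neg this (mul_neg_of_pos_of_neg this h3)
    linarith
  obtain ⟨hp0, hpJ, hp1⟩ := hp
  have hpos : ∀ s, 0 < p s → cB M (simpleRoot s) p < 0 := by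
    intro s hs
    by_contra hcon
    push Not at hcon
    set b := cB M (simpleRoot s) p with hb
    have hps1 : p s ≤ 1 := hp1 ▸ le_sm hp0 s
    -- choose the step
    obtain ⟨e, he0, hes, he1, hee⟩ : ∃ e : ℝ, 0 < e ∧ e ≤ p s ∧ e < 1 ∧ e * (2 - l) < - 2 * l := by
      refine ⟨min (p s / 2) (-l / (2 - l)), ?_, ?_, ?_, ?_⟩
      · apply lt_min
        · linarith
        · apply div_pos <;> linarith
      · exact (min_le_left _ _).trans (by linarith)
      · exact (min_le_left _ _).trans_lt (by linarith)
      · calc _ ≤ (-l / (2 - l)) * (2 - l) := by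
              apply mul_le_mul_of_nonneg_right (min_le_right _ _); linarith
          _ = -l := by apply div_mul_cancel₀; linarith
          _ < _ := by linarith
    have hmem : (1 - e)⁻¹ • (p - e • simpleRoot s) ∈ S := by
      refine ⟨smul_nonneg (by simp; linarith) ?_, fun r hr => ?_, ?_⟩
      · intro i
        by_cases hi : i = s
        · subst hi; simp [simpleRoot]; linarith
        · simp [simpleRoot, hi]; exact hp0 i
      · have : r ≠ s := by rintro rfl; rw [hpJ r hr] at hs; exact lt_irrefl _ hs
        simp [simpleRoot, this, hpJ r hr]
      · rw [sm_smul, sm_sub, sm_smul, sm_simple, hp1, mul_one]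
        apply inv_mul_cancel₀; linarith
    have h1 := hpmin _ hmem
    simp only [map_smul, LinearMap.smul_apply, smul_eq_mul, map_sub, LinearMap.sub_apply,
      cB_single_single, coxEntry_self, cB_symm M p (simpleRoot s)] at h1
    rw [← hb, ← hl] at h1
    have h2 : 0 < 1 - e := by linarith
    have h3 : l * (1 - e) ^ 2 ≤ l - e * b - e * (b - e * 2) := by
      have := mul_le_mul_of_nonneg_right h1 (sq_nonneg (1 - e))
      refine this.trans (le_of_eq ?_)
      field_simp
    nlinarith
  have hpK : p ∈ coneK M := by
    rw [mem_K]
    refine ⟨hp0, fun s => ?_⟩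
    rcases (hp0 s).lt_or_eq with h | h
    · exact (hpos s h).le
    · rw [cB_single_left]
      refine Finset.sum_nonpos fun t _ => ?_
      by_cases hst : s = t
      · subst hst; rw [← h]; simp
      · exact mul_nonpos_of_nonneg_of_nonpos (hp0 t) (coxEntry_nonpos M hst)
  obtain ⟨s, hs⟩ : ∃ s, 0 < p s := by
    by_contra hcon
    push Not at hcon
    have : sm p ≤ 0 := Finset.sum_nonpos fun i _ => hcon i
    linarith
  have := hpJ s (hmax p hpK s (hpos s hs))
  linarith

/-- The vectors whose orbit stays in the nonnegative orthant. -/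
def Dset : Set (B → ℝ) := {v | ∀ w : W, 0 ≤ ρ w v}

omit hρ in
lemma rho_cont (w : W) : Continuous (fun v => ρ w v) :=
  LinearMap.continuous_of_finiteDimensional (ρ w : (B → ℝ) →ₗ[ℝ] (B → ℝ))

lemma imagCone_subset : imagCone M ρ ⊆ Dset ρ := by
  apply closure_minimal
  · rintro v ⟨w, k, hk, rfl⟩ u
    rw [← LinearEquiv.mul_apply, ← map_mul]
    exact ((mem_K M k).1 hk).1.trans (cone_le M cs ρ hρ k hk _)
  · have : Dset ρ = ⋂ w : W, (fun v => ρ w v) ⁻¹' (Set.Ici 0) := by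
      ext v; simp [Dset]
    rw [this]
    exact isClosed_iInter fun w => isClosed_Ici.preimage (rho_cont ρ w)

open Classical in
/-- projection to coordinates outside `J`. -/
noncomputable def pN (J : B → Prop) (v : B → ℝ) : B → ℝ := fun i => if J i then 0 else v i

lemma D_rad (x : B → ℝ) (hx : x ∈ coneK M)
    (hmax : ∀ y ∈ coneK M, ∀ s, cB M (simpleRoot s) y < 0 → cB M (simpleRoot s) x < 0)
    (v : B → ℝ) (hv : v ∈ Dset ρ) (s : B) (hs : ¬ cB M (simpleRoot s) x < 0) :
    cB M (simpleRoot s) v = 0 := by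
  set J : B → Prop := fun s => cB M (simpleRoot s) x < 0 with hJ
  have horth := max_orth M x hx hmax
  have hpsd := max_psd M x hx hmax
  have hproj : ∀ (u : B → ℝ) (r : B), ¬ J r → cB M (simpleRoot r) (pN J u) =
      cB M (simpleRoot r) u := by
    intro u r hr
    rw [cB_single_left, cB_single_left]
    refine Finset.sum_congr rfl fun t _ => ?_
    by_cases ht : J t
    · rw [horth r t hr ht]; simp
    · simp [pN, ht]
  have hstepJ : ∀ (u : B → ℝ) (r : B), J r → pN J (ρ (cs.simple r) u) = pN J u := by
    intro u r hr
    ext i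
    simp only [pN]
    split_ifs with hi
    · rfl
    · have : i ≠ r := by rintro rfl; exact hi hr
      rw [rho_simple M cs ρ hρ]; simp [simpleRoot, this]
  have hstepN : ∀ (u : B → ℝ) (r : B), ¬ J r → pN J (ρ (cs.simple r) u) =
      ρ (cs.simple r) (pN J u) := by
    intro u r hr
    rw [rho_simple M cs ρ hρ, rho_simple M cs ρ hρ, hproj u r hr]
    ext i
    simp only [pN, Pi.sub_apply, Pi.smul_apply]
    split_ifs with hi
    · have : i ≠ r := by rintro rfl; exact hr hi
      simp [simpleRoot, this]
    · rfl
  have hq : ∀ w : W, cB M (pN J (ρ w v)) (pN J (ρ w v)) = cB M (pN J v) (pN J v) := by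
    intro w
    induction w using cs.simple_induction_left with
    | one => simp
    | mul_simple_left w r ih =>
      rw [map_mul, LinearEquiv.mul_apply]
      by_cases hr : J r
      · rw [hstepJ _ _ hr, ih]
      · rw [hstepN _ _ hr, cB_inv M cs ρ hρ, ih]
  let O : Set (B → ℝ) := Set.range fun w : W => pN J (ρ w v)
  let S : Set (B → ℝ) := closure O ∩ {p | sm p ≤ sm (pN J v)}
  have hO0 : ∀ p ∈ closure O, 0 ≤ p := by
    intro p hp
    have : closure O ⊆ Set.Ici 0 := by
      apply closure_minimal _ isClosed_Ici
      rintro _ ⟨w, rfl⟩ i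
      simp only [pN, Pi.zero_apply]
      split_ifs
      · rfl
      · exact hv w i
    exact this hp
  have hOJ : ∀ r, J r → ∀ p ∈ closure O, p r = 0 := by
    intro r hr p hp
    have : closure O ⊆ {p | p r = 0} := by
      apply closure_minimal _ (isClosed_eq (continuous_apply r) continuous_const)
      rintro _ ⟨w, rfl⟩
      simp [pN, hr]
    exact this hp
  have hOq : ∀ p ∈ closure O, cB M p p = cB M (pN J v) (pN J v) := by
    intro p hp
    have : closure O ⊆ {p | cB M p p = cB M (pN J v) (pN J v)} := by
      apply closure_minimal _ (isClosed_eq (q_cont M) continuous_const)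
      rintro _ ⟨w, rfl⟩
      exact hq w
    exact this hp
  have hOs : ∀ r, ¬ J r → ∀ p ∈ closure O, ρ (cs.simple r) p ∈ closure O := by
    intro r hr p hp
    have hm : Set.MapsTo (fun p => ρ (cs.simple r) p) O O := by
      rintro _ ⟨w, rfl⟩
      refine ⟨cs.simple r * w, ?_⟩
      simp only
      rw [map_mul, LinearEquiv.mul_apply, hstepN _ _ hr]
    exact hm.closure (rho_cont ρ _) hp
  have hv0 : pN J v ∈ closure O := subset_closure ⟨1, by simp⟩
  have hScomp : IsCompact S := compact_slice S
    (isClosed_closure.inter (isClosed_le sm_cont continuous_const))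
    (fun p hp => hO0 p hp.1) _ (fun p hp => hp.2)
  obtain ⟨u, hu, humin⟩ := hScomp.exists_isMinOn ⟨pN J v, hv0, by simp⟩ sm_cont.continuousOn
  have humin' : ∀ p ∈ closure O, sm u ≤ sm p := by
    intro p hp
    by_cases h : sm p ≤ sm (pN J v)
    · exact humin (⟨hp, h⟩ : p ∈ S)
    · exact hu.2.trans (not_le.1 h).le
  have hneg : ∀ r, ¬ J r → cB M (simpleRoot r) u ≤ 0 := by
    intro r hr
    have := humin' _ (hOs r hr u hu.1)
    rw [rho_simple M cs ρ hρ, sm_sub, sm_smul, sm_simple] at this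
    linarith
  have hqu : cB M u u ≤ 0 := by
    rw [cB_eq_sum]
    refine Finset.sum_nonpos fun r _ => ?_
    by_cases hr : J r
    · rw [hOJ r hr u hu.1]; simp
    · exact mul_nonpos_of_nonneg_of_nonpos (hO0 u hu.1 r) (hneg r hr)
  rw [hOq u hu.1] at hqu
  rw [← hproj v s hs]
  set b := cB M (simpleRoot s) (pN J v) with hb
  have h1 := hpsd (pN J v + (-b / 2) • simpleRoot s) (by
    intro r hr
    have : r ≠ s := by rintro rfl; exact hs hr
    have hr' : J r := hr
    simp [pN, hr', simpleRoot, this])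
  simp only [map_smul, LinearMap.smul_apply, smul_eq_mul, map_add, LinearMap.add_apply,
      cB_single_single, coxEntry_self, cB_symm M (pN J v) (simpleRoot s)] at h1
  rw [← hb] at h1
  have : b ^ 2 ≤ 0 := by nlinarith
  exact pow_eq_zero_iff (two_ne_zero) |>.1 (le_antisymm this (sq_nonneg b))

lemma filter_word (J : B → Prop) [DecidablePred J]
    (horth : ∀ s t, ¬ J s → J t → coxEntry M s t = 0)
    (y : B → ℝ) (hy : ∀ s, ¬ J s → cB M (simpleRoot s) y = 0) (ω : List B) :
    ρ (cs.wordProd ω) y = ρ (cs.wordProd (ω.filter (fun s => decide (J s)))) y ∧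
    ∀ s, ¬ J s → cB M (simpleRoot s) (ρ (cs.wordProd ω) y) = 0 := by
  induction ω with
  | nil => simpa using hy
  | cons t ω ih =>
    obtain ⟨h1, h2⟩ := ih
    rw [cs.wordProd_cons, map_mul, LinearEquiv.mul_apply]
    by_cases ht : J t
    · constructor
      · rw [List.filter_cons_of_pos (by simpa using ht), cs.wordProd_cons, map_mul,
          LinearEquiv.mul_apply, h1]
      · intro s hs
        rw [rho_simple M cs ρ hρ, map_sub, map_smul, cB_single_single, horth s t hs ht, h2 s hs]
        simp
    · have : ρ (cs.simple t) (ρ (cs.wordProd ω) y) = ρ (cs.wordProd ω) y := by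
        rw [rho_simple M cs ρ hρ, h2 t ht]; simp
      rw [this, List.filter_cons_of_neg (by simpa using ht)]
      exact ⟨h1, h2⟩

lemma D_perturb (x : B → ℝ) (hx : x ∈ coneK M)
    (hmax : ∀ y ∈ coneK M, ∀ s, cB M (simpleRoot s) y < 0 → cB M (simpleRoot s) x < 0)
    (v : B → ℝ) (hv : v ∈ Dset ρ) (e : ℝ) (he : 0 < e) :
    ∃ w : W, ∃ k ∈ coneK M, v + e • x = ρ w k := by
  classical
  set J : B → Prop := fun s => cB M (simpleRoot s) x < 0 with hJ
  have horth := max_orth M x hx hmax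
  have hx' := (mem_K M x).1 hx
  set y := v + e • x with hy
  have hyN : ∀ s, ¬ J s → cB M (simpleRoot s) y = 0 := by
    intro s hs
    rw [hy, map_add, map_smul, D_rad M cs ρ hρ x hx hmax v hv s hs]
    have : cB M (simpleRoot s) x = 0 := le_antisymm (hx'.2 s) (not_lt.1 hs)
    rw [this]; simp
  obtain ⟨c, hc0, hc⟩ : ∃ c : ℝ, 0 < c ∧ ∀ s, J s → c ≤ - cB M (simpleRoot s) x := by
    by_cases hne : (Finset.univ.filter J).Nonempty
    · obtain ⟨s0, hs0, hmin⟩ := Finset.exists_min_image (Finset.univ.filter J)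
        (fun s => - cB M (simpleRoot s) x) hne
      refine ⟨- cB M (simpleRoot s0) x, ?_, fun s hs => hmin s (by simpa using hs)⟩
      have : J s0 := by simpa using hs0
      simpa [hJ] using this
    · refine ⟨1, one_pos, fun s hs => ?_⟩
      exact absurd ⟨s, by simpa using hs⟩ hne
  have hy0 : ∀ w, 0 ≤ ρ w y := by
    intro w
    rw [hy, map_add, map_smul]
    exact add_nonneg (hv w) (smul_nonneg he.le (hx'.1.trans (cone_le M cs ρ hρ x hx w)))
  obtain ⟨n, hn⟩ := exists_nat_gt (sm y / (e * c))
  let F : Set (B → ℝ) := (fun ω => ρ (cs.wordProd ω) y) '' {ω : List B | ω.length ≤ n}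
  have hF : F.Finite := (List.finite_length_le B n).image _
  let S : Set (B → ℝ) := {p | (∃ w : W, p = ρ w y) ∧ sm p ≤ sm y}
  have hSF : S ⊆ F := by
    rintro p ⟨⟨w, rfl⟩, hp⟩
    obtain ⟨ω, h1, h2⟩ := cs.exists_isReduced w⁻¹
    have hg := (cone_grow M cs ρ hρ x hx J c hc ω h1).2
    rw [← h2, inv_inv] at hg
    have hw : w = cs.wordProd ω.reverse := by rw [cs.wordProd_reverse, ← h2, inv_inv]
    refine ⟨ω.reverse.filter (fun s => decide (J s)), ?_, ?_⟩
    · simp only [Set.mem_ofPred_eq]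
      rw [← List.countP_eq_length_filter, List.countP_reverse]
      have h3 : sm (ρ w y) = sm (ρ w v) + e * sm (ρ w x) := by
        rw [hy, map_add, map_smul, sm_add, sm_smul]
      have h4 := sm_nonneg (hv w)
      have h5 := sm_nonneg hx'.1
      rw [div_lt_iff₀ (by positivity)] at hn
      have h6 : e * c * (ω.countP (fun s => decide (J s)) : ℝ) ≤ sm y := by
        nlinarith
      have h7 : (ω.countP (fun s => decide (J s)) : ℝ) < n := by
        by_contra hcon
        push Not at hcon
        have : 0 < e * c := by positivity
        nlinarith
      exact_mod_cast h7.le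
    · simp only
      rw [← (filter_word M cs ρ hρ J (fun s t hs ht => horth s t hs ht) y hyN ω.reverse).1, ← hw]
  have hyS : y ∈ S := ⟨⟨1, by simp⟩, le_rfl⟩
  obtain ⟨p, hp, hpmin⟩ := Set.exists_min_image S sm (hF.subset hSF) ⟨y, hyS⟩
  obtain ⟨⟨w, hw⟩, hpy⟩ := hp
  refine ⟨w⁻¹, p, ?_, ?_⟩
  · rw [mem_K]
    refine ⟨hw ▸ hy0 w, fun s => ?_⟩
    by_contra hcon
    push Not at hcon
    have hlt : sm (ρ (cs.simple s) p) < sm p := by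
      rw [rho_simple M cs ρ hρ, sm_sub, sm_smul, sm_simple]; linarith
    have := hpmin (ρ (cs.simple s) p) ⟨⟨cs.simple s * w, by rw [hw]; simp⟩, by linarith⟩
    linarith
  · rw [hw, ← LinearEquiv.mul_apply, ← map_mul]; simp

lemma imagCone_eq : imagCone M ρ = Dset ρ := by
  apply (imagCone_subset M cs ρ hρ).antisymm
  intro v hv
  obtain ⟨x, hx, hmax⟩ := exists_max M
  have ht : Filter.Tendsto (fun n : ℕ => v + (1 / ((n : ℝ) + 1)) • x) Filter.atTop
      (nhds (v + (0 : ℝ) • x)) :=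
    tendsto_const_nhds.add (tendsto_one_div_add_atTop_nhds_zero_nat.smul_const x)
  rw [zero_smul, add_zero] at ht
  refine mem_closure_of_tendsto ht (Filter.Eventually.of_forall fun n => ?_)
  exact D_perturb M cs ρ hρ x hx hmax v hv _ (by positivity)

omit hρ in
lemma evalR_cont (f : B → ℝ) : Continuous (fun v => evalR f v) := by
  unfold evalR; fun_prop

omit hρ in
lemma evalR_add (f u v : B → ℝ) : evalR f (u + v) = evalR f u + evalR f v := by
  simp [evalR, add_mul, Finset.sum_add_distrib]

omit hρ in
lemma evalR_smul (f : B → ℝ) (r : ℝ) (v : B → ℝ) : evalR f (r • v) = r * evalR f v := by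
  simp [evalR, Finset.mul_sum, mul_assoc]

lemma pos_bound (f : B → ℝ) (hf : ∀ v ∈ Dset ρ, v ≠ 0 → 0 < evalR f v) :
    ∃ n : ℕ, ∀ w : W, n ≤ cs.length w → 0 < evalR f (xw ρ w) := by
  by_contra hcon
  push Not at hcon
  choose w hw1 hw2 using fun n : ℕ => hcon (n + 1)
  set c : ℕ → ℝ := fun n => sm (xw ρ (w n)) with hc
  have hcn : ∀ n : ℕ, (n : ℝ) + 1 ≤ c n := by
    intro n
    have h1 := xw_length M cs ρ hρ (w n)
    have h2 : ((n + 1 : ℕ) : ℝ) ≤ cs.length (w n) := by exact_mod_cast hw1 n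
    push_cast at h2
    exact h2.trans h1
  have hcpos : ∀ n, 0 < c n := fun n => lt_of_lt_of_le (by positivity) (hcn n)
  have hclim : Filter.Tendsto (fun n => (c n)⁻¹) Filter.atTop (nhds 0) := by
    refine squeeze_zero (fun n => (inv_pos.2 (hcpos n)).le) (fun n => ?_)
      tendsto_one_div_add_atTop_nhds_zero_nat
    rw [one_div]
    exact inv_anti₀ (by positivity) (hcn n)
  let S : Set (B → ℝ) := Set.Ici 0 ∩ {p | sm p = 1}
  have hS : IsCompact S := compact_slice S
    (isClosed_Ici.inter (isClosed_eq sm_cont continuous_const)) (fun p hp => hp.1) 1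
    (fun p hp => le_of_eq hp.2)
  have hpS : ∀ n, (c n)⁻¹ • xw ρ (w n) ∈ S := by
    intro n
    refine ⟨smul_nonneg (inv_pos.2 (hcpos n)).le (xw_nonneg ρ _), ?_⟩
    simp only [Set.mem_ofPred_eq]
    rw [sm_smul]
    exact inv_mul_cancel₀ (hcpos n).ne'
  obtain ⟨v, hv, φ, hφ, hlim⟩ := hS.tendsto_subseq hpS
  have hsv : sm v = 1 := hv.2
  have hvD : v ∈ Dset ρ := by
    intro u
    have h1 : Filter.Tendsto (fun n => ρ u ((c (φ n))⁻¹ • xw ρ (w (φ n))) +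
        (c (φ n))⁻¹ • xw ρ u⁻¹) Filter.atTop (nhds (ρ u v + (0 : ℝ) • xw ρ u⁻¹)) := by
      refine Filter.Tendsto.add ?_ ?_
      · exact ((rho_cont ρ u).tendsto v).comp hlim
      · exact (hclim.comp hφ.tendsto_atTop).smul_const _
    rw [zero_smul, add_zero] at h1
    refine ge_of_tendsto' h1 fun n => ?_
    rw [map_smul, xw_cocycle M cs ρ hρ, ← smul_add, sub_add_cancel]
    exact smul_nonneg (inv_pos.2 (hcpos _)).le (xw_nonneg ρ _)
  have hv0 : v ≠ 0 := by
    rintro rfl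
    simp [sm] at hsv
  have h2 : evalR f v ≤ 0 := by
    refine le_of_tendsto' (((evalR_cont f).tendsto v).comp hlim) fun n => ?_
    simp only [Function.comp]
    rw [evalR_smul]
    exact mul_nonpos_of_nonneg_of_nonpos (inv_pos.2 (hcpos _)).le (hw2 _)
  exact absurd (hf v hvD hv0) (not_lt.2 h2)

lemma mem_tits (f : B → ℝ) (hf : ∀ v ∈ Dset ρ, v ≠ 0 → 0 < evalR f v) :
    f ∈ titsConeCoord ρ := by
  obtain ⟨n, hn⟩ := pos_bound M cs ρ hρ f hf
  let S : Set W := {w | evalR f (xw ρ w) ≤ 0}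
  have hS : S.Finite := by
    have : ((fun ω => cs.wordProd ω) '' {ω : List B | ω.length ≤ n}).Finite :=
      (List.finite_length_le B n).image _
    refine this.subset ?_
    intro w hw
    obtain ⟨ω, h1, h2⟩ := cs.exists_isReduced w
    refine ⟨ω, ?_, h2.symm⟩
    simp only [Set.mem_ofPred_eq]
    by_contra hcon
    have h3 := hn w (by rw [h2, h1.eq]; omega)
    have : evalR f (xw ρ w) ≤ 0 := hw
    linarith
  have h1S : evalR f (xw ρ (1 : W)) ≤ 0 := by
    rw [xw_one M cs ρ hρ]; simp [evalR]
  obtain ⟨w, hw, hmin⟩ := Set.exists_min_image S (fun w => evalR f (xw ρ w)) hS ⟨1, h1S⟩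
  have hw : evalR f (xw ρ w) ≤ 0 := hw
  refine ⟨w⁻¹, fun s => ?_⟩
  by_contra hcon
  push Not at hcon
  have h2 : evalR f (xw ρ (cs.simple s * w)) = evalR f (xw ρ w) +
      evalR f (ρ w⁻¹ (simpleRoot s)) := by
    rw [xw_simple_mul M cs ρ hρ, evalR_add]
  have h3 := hmin (cs.simple s * w) (by
    change evalR f (xw ρ (cs.simple s * w)) ≤ 0
    linarith)
  linarith

omit hρ in
lemma Dset_nonneg (v : B → ℝ) (hv : v ∈ Dset ρ) : 0 ≤ v := by
  simpa using hv 1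

omit hρ in
lemma Dset_closed : IsClosed (Dset ρ) := by
  have : Dset ρ = ⋂ w : W, (fun v => ρ w v) ⁻¹' (Set.Ici 0) := by
    ext v; simp [Dset]
  rw [this]
  exact isClosed_iInter fun w => isClosed_Ici.preimage (rho_cont ρ w)

omit hρ in
lemma Dset_smul (v : B → ℝ) (hv : v ∈ Dset ρ) (r : ℝ) (hr : 0 ≤ r) : r • v ∈ Dset ρ := by
  intro w; rw [map_smul]; exact smul_nonneg hr (hv w)

omit hρ in
lemma Dset_add (u v : B → ℝ) (hu : u ∈ Dset ρ) (hv : v ∈ Dset ρ) : u + v ∈ Dset ρ := by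
  intro w; rw [map_add]; exact add_nonneg (hu w) (hv w)

omit hρ in
lemma sm_pos (v : B → ℝ) (h0 : 0 ≤ v) (hv : v ≠ 0) : 0 < sm v := by
  rcases (sm_nonneg h0).lt_or_eq with h | h
  · exact h
  exfalso
  apply hv
  ext i
  exact le_antisymm (by rw [Pi.zero_apply, h]; exact le_sm h0 i) (h0 i)

/-- A compact base of the cone. -/
def slice : Set (B → ℝ) := Dset ρ ∩ {p | sm p = 1}

omit hρ in
lemma slice_compact : IsCompact (slice ρ) :=
  compact_slice _ ((Dset_closed ρ).inter (isClosed_eq sm_cont continuous_const))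
    (fun p hp => Dset_nonneg ρ p hp.1) 1 (fun p hp => le_of_eq hp.2)

omit hρ in
lemma slice_ne (p : B → ℝ) (hp : p ∈ slice ρ) : p ≠ 0 := by
  rintro rfl
  have : sm (0 : B → ℝ) = 1 := hp.2
  simp [sm] at this

omit hρ in
lemma slice_mem (v : B → ℝ) (hv : v ∈ Dset ρ) (h0 : v ≠ 0) : (sm v)⁻¹ • v ∈ slice ρ := by
  have := sm_pos v (Dset_nonneg ρ v hv) h0
  refine ⟨Dset_smul ρ v hv _ (inv_pos.2 this).le, ?_⟩
  simp only [Set.mem_ofPred_eq]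
  rw [sm_smul]
  exact inv_mul_cancel₀ this.ne'

lemma mem_interior_tits (f : B → ℝ) (hf : ∀ v ∈ Dset ρ, v ≠ 0 → 0 < evalR f v) :
    f ∈ interior (titsConeCoord ρ) := by
  obtain ⟨m, hm0, hm⟩ : ∃ m : ℝ, 0 < m ∧ ∀ p ∈ slice ρ, m ≤ evalR f p := by
    by_cases hne : (slice ρ).Nonempty
    · obtain ⟨p, hp, hmin⟩ := (slice_compact ρ).exists_isMinOn hne (evalR_cont f).continuousOn
      exact ⟨evalR f p, hf p hp.1 (slice_ne ρ p hp), fun p' hp' => hmin hp'⟩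
    · exact ⟨1, one_pos, fun p hp => absurd ⟨p, hp⟩ hne⟩
  rw [mem_interior_iff_mem_nhds, Metric.mem_nhds_iff]
  refine ⟨m, hm0, fun g hg => ?_⟩
  apply mem_tits M cs ρ hρ
  intro v hv hv0
  have hv' := Dset_nonneg ρ v hv
  have hsv := sm_pos v hv' hv0
  have h1 := hm _ (slice_mem ρ v hv hv0)
  rw [evalR_smul] at h1
  have h2 : m * sm v ≤ evalR f v := by
    rw [inv_mul_eq_div, le_div_iff₀ hsv] at h1
    exact h1
  have hd : dist g f < m := hg
  have h3 : evalR f v - evalR g v ≤ dist g f * sm v := by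
    unfold evalR sm
    rw [← Finset.sum_sub_distrib, Finset.mul_sum]
    refine Finset.sum_le_sum fun i _ => ?_
    have h4 := dist_le_pi_dist g f i
    rw [Real.dist_eq] at h4
    have h5 := neg_abs_le (g i - f i)
    have h6 := hv' i
    simp only [Pi.zero_apply] at h6
    nlinarith
  nlinarith

omit hρ in
lemma evalC_im (z : B → ℂ) (v : B → ℝ) : (evalC z v).im = evalR (fun i => (z i).im) v := by
  simp [evalC, evalR]

omit hρ in
lemma evalC_add (z : B → ℂ) (u v : B → ℝ) : evalC z (u + v) = evalC z u + evalC z v := by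
  simp [evalC, add_mul, Finset.sum_add_distrib]

omit hρ in
lemma evalC_smul (z : B → ℂ) (r : ℝ) (v : B → ℝ) : evalC z (r • v) = r * evalC z v := by
  simp [evalC, Finset.mul_sum, mul_assoc]

omit hρ in
lemma evalC_cont (z : B → ℂ) : Continuous (fun v => evalC z v) := by
  unfold evalC; fun_prop

lemma im_pos (z : B → ℂ) (hz : z ∈ upsRegN M ρ) (v : B → ℝ) (hv : v ∈ Dset ρ) (hv0 : v ≠ 0) :
    0 < (evalC z v).im := by
  have hI := imagCone_eq M cs ρ hρ
  unfold upsRegN at hz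
  rw [if_neg (by rw [hI]; intro h; rw [h] at hv; exact hv0 hv)] at hz
  obtain ⟨⟨hreg, -⟩, hphi⟩ := hz
  unfold phiI at hphi
  rw [hI] at hreg hphi
  set A : Set ℝ := Complex.arg '' ((fun v => evalC z v) '' (Dset ρ \ {0})) with hA
  have hAeq : A = (fun v => Complex.arg (evalC z v)) '' slice ρ := by
    rw [hA, Set.image_image]
    ext a
    constructor
    · rintro ⟨u, ⟨hu, hu0⟩, rfl⟩
      have hu0 : u ≠ 0 := hu0
      refine ⟨_, slice_mem ρ u hu hu0, ?_⟩
      have := sm_pos u (Dset_nonneg ρ u hu) hu0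
      simp only
      rw [evalC_smul, Complex.arg_real_mul _ (inv_pos.2 this)]
    · rintro ⟨u, hu, rfl⟩
      exact ⟨u, ⟨hu.1, slice_ne ρ u hu⟩, rfl⟩
  have hmemA : ∀ u ∈ Dset ρ, u ≠ 0 → Complex.arg (evalC z u) ∈ A := fun u hu hu0 =>
    ⟨_, ⟨u, ⟨hu, hu0⟩, rfl⟩, rfl⟩
  have hAne : A.Nonempty := ⟨_, hmemA v hv hv0⟩
  have hAb : BddAbove A := ⟨Real.pi, by rintro _ ⟨u, -, rfl⟩; exact Complex.arg_le_pi u⟩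
  have hAb' : BddBelow A := ⟨-Real.pi, by
    rintro _ ⟨u, -, rfl⟩; exact (Complex.neg_pi_lt_arg u).le⟩
  have hsup : sSup A ≤ Real.pi := csSup_le hAne (by
    rintro _ ⟨u, -, rfl⟩; exact Complex.arg_le_pi u)
  have hsum : sSup A + sInf A = Real.pi := by linarith
  have him : ∀ u ∈ Dset ρ, u ≠ 0 → 0 ≤ (evalC z u).im := by
    intro u hu hu0
    rw [← Complex.arg_nonneg_iff]
    have := csInf_le hAb' (hmemA u hu hu0)
    linarith
  have hcont : ContinuousOn (fun v => Complex.arg (evalC z v)) (slice ρ) := by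
    have h1 : ContinuousOn Complex.arg {c : ℂ | 0 ≤ c.im ∧ c ≠ 0} := by
      rintro c ⟨hc1, hc2⟩
      by_cases hs : c ∈ Complex.slitPlane
      · exact (Complex.continuousAt_arg hs).continuousWithinAt
      · rw [Complex.mem_slitPlane_iff] at hs
        push Not at hs
        have hre : c.re < 0 := by
          refine lt_of_le_of_ne hs.1 fun h => hc2 ?_
          exact Complex.ext h hs.2
        exact (Complex.continuousWithinAt_arg_of_re_neg_of_im_zero hre hs.2).mono
          (fun d hd => hd.1)
    exact h1.comp (evalC_cont z).continuousOn
      (fun u hu => ⟨him u hu.1 (slice_ne ρ u hu), hreg u hu.1 (slice_ne ρ u hu)⟩)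
  have hAc : IsCompact A := by rw [hAeq]; exact (slice_compact ρ).image_of_continuousOn hcont
  have hsm := hAc.sSup_mem hAne
  have him' := hAc.sInf_mem hAne
  by_contra hcon
  have h0 : (evalC z v).im = 0 := le_antisymm (not_lt.1 hcon) (him v hv hv0)
  have hinf : sInf A = 0 := by
    have h1 := csInf_le hAb' (hmemA v hv hv0)
    have h2 := le_csSup hAb (hmemA v hv hv0)
    rcases le_or_gt 0 (evalC z v).re with hre | hre
    · have : Complex.arg (evalC z v) = 0 := Complex.arg_eq_zero_iff.2 ⟨hre, h0⟩
      linarith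
    · have : Complex.arg (evalC z v) = Real.pi := Complex.arg_eq_pi_iff.2 ⟨hre, h0⟩
      linarith
  have hsup' : sSup A = Real.pi := by linarith
  rw [hsup'] at hsm
  rw [hinf] at him'
  obtain ⟨_, ⟨v1, ⟨hv1, hv10⟩, rfl⟩, ha1⟩ := him'
  obtain ⟨_, ⟨v2, ⟨hv2, hv20⟩, rfl⟩, ha2⟩ := hsm
  have hv10 : v1 ≠ 0 := hv10
  have hv20 : v2 ≠ 0 := hv20
  simp only at ha1 ha2
  rw [Complex.arg_eq_zero_iff] at ha1
  rw [Complex.arg_eq_pi_iff] at ha2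
  set r1 := (evalC z v1).re with hr1
  set r2 := (evalC z v2).re with hr2
  have hr1' : 0 < r1 := by
    refine lt_of_le_of_ne ha1.1 fun h => hreg v1 hv1 hv10 ?_
    exact Complex.ext h.symm ha1.2
  have hp1 : (-r2) • v1 ∈ Dset ρ := Dset_smul ρ v1 hv1 _ (by linarith)
  have hp2 : r1 • v2 ∈ Dset ρ := Dset_smul ρ v2 hv2 _ hr1'.le
  refine hreg _ (Dset_add ρ _ _ hp1 hp2) ?_ ?_
  · intro h
    have h1 : sm ((-r2) • v1 + r1 • v2) = 0 := by rw [h]; simp [sm]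
    rw [sm_add, sm_smul, sm_smul] at h1
    have h2 := sm_pos v1 (Dset_nonneg ρ v1 hv1) hv10
    have h3 := sm_pos v2 (Dset_nonneg ρ v2 hv2) hv20
    nlinarith [ha2.1, mul_pos hr1' h3, mul_pos (neg_pos.2 ha2.1) h2]
  · rw [evalC_add, evalC_smul, evalC_smul]
    apply Complex.ext
    · simp [← hr1, ← hr2]; ring
    · simp [ha1.2, ha2.2]

end Aux

/-!
STATEMENT 11: For every Z ∈ Υ_reg^N (a normalised point of the hyperplane complement), the
imaginary part Z_im lies in the interior T° of the Tits cone.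
-/
theorem imaginary_part_mem_interior_titsCone
    {B : Type*} [Fintype B] [DecidableEq B] (M : CoxeterMatrix B)
    {W : Type*} [Group W] (cs : CoxeterSystem M W)
    (ρ : W →* ((B → ℝ) ≃ₗ[ℝ] (B → ℝ)))
    (hρ : ∀ (s : B) (v : B → ℝ),
      ρ (cs.simple s) v = v - coxForm M (simpleRoot s) v • simpleRoot s)
    (z : B → ℂ) (hz : z ∈ upsRegN M ρ) :
    (fun i => (z i).im) ∈ interior (titsConeCoord ρ) := by

  apply mem_interior_tits M cs ρ hρ
  intro v hv hv0
  rw [← evalC_im]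
  exact im_pos M cs ρ hρ z hz v hv hv0
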